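/- arXiv:1008.2991 — 11 statements merged into one kernel-verified Lean document; each statement's English description precedes it below -/
import Mathlib

section
/- Let p and q be distinct odd primes, n = pq, φ = (p−1)(q−1), and let r be a positive integer with r ∣ p−1, gcd(r, (p−1)/r) = 1 and gcd(r, q−1) = 1. Let y be an integer coprime to n, let g be a primitive root modulo p, and let α be an integer with y ≡ g^α (mod p). Then the following three properties are equivalent: (a) gcd(α, r) = 1; (b) decryption works unambiguously, i.e. for all integers m₁, m₂ and all integers u₁, u₂ coprime to n, y^{m₁}·u₁^r ≡ y^{m₂}·u₂^r (mod n) implies m₁ ≡ m₂ (mod r); (c) for every prime s dividing r, y^{φ/s} ≢ 1 (mod n). -/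
/-- If every unit modulo an odd prime `p` is a power of `g`, then `g` is a unit modulo `p`. -/
lemma isUnit_of_forall_modEq_pow {p : ℕ} (hp : p.Prime) (hpodd : Odd p) {g : ℤ}
    (hg : ∀ z : ℤ, IsCoprime z (p : ℤ) → ∃ k : ℕ, z ≡ g ^ k [ZMOD (p : ℤ)]) :
    IsUnit (g : ZMod p) := by
  have : Fact p.Prime := ⟨hp⟩
  have : Fact (2 < p) := ⟨by have := hp.two_le; obtain ⟨k, hk⟩ := hpodd; omega⟩
  obtain ⟨k, hk⟩ := hg (-1) isCoprime_one_left.neg_left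
  have hk' : (-1 : ZMod p) = (g : ZMod p) ^ k := by
    exact_mod_cast (ZMod.intCast_eq_intCast_iff _ _ _).2 hk
  have hk0 : k ≠ 0 := by
    rintro rfl
    exact ZMod.neg_one_ne_one (by simpa using hk')
  exact (isUnit_pow_iff hk0).1 (hk' ▸ isUnit_one.neg)

/-- Powers of a primitive root modulo `p` agree iff the exponents agree modulo `p - 1`. -/
lemma pow_modEq_pow_iff_of_forall_modEq_pow {p : ℕ} (hp : p.Prime) (hpodd : Odd p) {g : ℤ}
    (hg : ∀ z : ℤ, IsCoprime z (p : ℤ) → ∃ k : ℕ, z ≡ g ^ k [ZMOD (p : ℤ)]) (a b : ℕ) :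
    g ^ a ≡ g ^ b [ZMOD (p : ℤ)] ↔ a ≡ b [MOD p - 1] := by
  have : Fact p.Prime := ⟨hp⟩
  obtain ⟨G, hG⟩ := isUnit_of_forall_modEq_pow hp hpodd hg
  have hord : orderOf G = p - 1 := by
    rw [← ZMod.card_units p, ← Nat.card_eq_fintype_card]
    refine orderOf_eq_card_of_forall_mem_zpowers fun x ↦ ?_
    obtain ⟨z, hz⟩ := ZMod.intCast_surjective (x : ZMod p)
    obtain ⟨k, hk⟩ := hg z ((ZMod.coe_int_isUnit_iff_isCoprime z p).1 (hz ▸ x.isUnit)).symm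
    refine ⟨k, ?_⟩
    ext
    have := (ZMod.intCast_eq_intCast_iff _ _ _).2 hk
    push_cast at this
    simp [hG, ← this, hz]
  rw [← ZMod.intCast_eq_intCast_iff, ← hord, ← pow_eq_pow_iff_modEq]
  push_cast
  rw [← hG]
  norm_cast

/-- Every unit modulo a prime `q` is an `r`-th power when `r` is coprime to `q - 1`. -/
lemma exists_pow_modEq_of_coprime {q r : ℕ} (hq : q.Prime) (hr : r.Coprime (q - 1)) {y : ℤ}
    (hy : IsCoprime y (q : ℤ)) : ∃ u : ℤ, u ^ r ≡ y [ZMOD (q : ℤ)] := by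
  have : Fact q.Prime := ⟨hq⟩
  obtain ⟨Y, hY⟩ := (ZMod.coe_int_isUnit_iff_isCoprime y q).2 hy.symm
  have hc : (Nat.card (ZMod q)ˣ).Coprime r := by
    rw [Nat.card_eq_fintype_card, ZMod.card_units]
    exact hr.symm
  obtain ⟨U, hU⟩ := (powCoprime hc).surjective Y
  obtain ⟨u, hu⟩ := ZMod.intCast_surjective (U : ZMod q)
  refine ⟨u, (ZMod.intCast_eq_intCast_iff _ _ _).1 ?_⟩
  push_cast
  rw [hu, ← hY, ← hU]
  simp

/-- Chinese remaindering for congruences modulo a product of distinct primes. -/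
lemma modEq_mul_iff_of_primes {p q : ℕ} (hp : p.Prime) (hq : q.Prime) (hpq : p ≠ q) (a b : ℤ) :
    a ≡ b [ZMOD ((p * q : ℕ) : ℤ)] ↔ a ≡ b [ZMOD (p : ℤ)] ∧ a ≡ b [ZMOD (q : ℤ)] := by
  rw [Int.modEq_and_modEq_iff_modEq_mul (by simpa using (Nat.coprime_primes hp hq).2 hpq)]
  push_cast
  rfl

theorem benaloh_fixed (p q n : ℕ) (hp : p.Prime) (hq : q.Prime)
    (hpodd : Odd p) (hqodd : Odd q) (hpq : p ≠ q)
    (hn : n = p * q) (φ : ℕ) (hφ : φ = (p - 1) * (q - 1)) (r : ℕ) (hr : 0 < r) (hrp : r ∣ p - 1)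
    (hr1 : Nat.Coprime r ((p - 1) / r)) (hr2 : Nat.Coprime r (q - 1)) (y : ℤ) (hy : IsCoprime y (n : ℤ))
    (g : ℤ)
    (hg : ∀ z : ℤ, IsCoprime z (p : ℤ) → ∃ k : ℕ, z ≡ g ^ k [ZMOD (p : ℤ)])
    (α : ℕ) (hα : y ≡ g ^ α [ZMOD (p : ℤ)]) :
    (Nat.Coprime α r ↔
      (∀ (m₁ m₂ : ℕ) (u₁ u₂ : ℤ), IsCoprime u₁ (n : ℤ) → IsCoprime u₂ (n : ℤ) →
      y ^ m₁ * u₁ ^ r ≡ y ^ m₂ * u₂ ^ r [ZMOD (n : ℤ)] → m₁ ≡ m₂ [MOD r])) ∧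
    (Nat.Coprime α r ↔
      (∀ s : ℕ, s.Prime → s ∣ r → ¬ (y ^ (φ / s) ≡ 1 [ZMOD (n : ℤ)]))) := by
  subst hn hφ
  have hp1 : 0 < p - 1 := by have := hp.two_le; omega
  have hyq : IsCoprime y (q : ℤ) := by
    push_cast at hy; exact hy.of_mul_right_right
  have hpow := pow_modEq_pow_iff_of_forall_modEq_pow hp hpodd hg
  have hcrt := modEq_mul_iff_of_primes hp hq hpq
  refine ⟨⟨fun h m₁ m₂ u₁ u₂ h₁ h₂ heq ↦ ?_, fun h ↦ ?_⟩, ?_⟩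
  · push_cast at h₁ h₂
    obtain ⟨k₁, hk₁⟩ := hg u₁ h₁.of_mul_right_left
    obtain ⟨k₂, hk₂⟩ := hg u₂ h₂.of_mul_right_left
    have e := (((hα.pow m₁).mul (hk₁.pow r)).symm.trans ((hcrt _ _).1 heq).1).trans
      ((hα.pow m₂).mul (hk₂.pow r))
    simp only [← pow_mul, ← pow_add] at e
    have e' : α * m₁ ≡ α * m₂ [MOD r] := by
      simpa [Nat.ModEq] using ((hpow _ _).1 e).of_dvd hrp
    exact e'.cancel_left_of_coprime h.symm
  · obtain ⟨a, ha⟩ := Nat.gcd_dvd_left α r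
    obtain ⟨b, hb⟩ := Nat.gcd_dvd_right α r
    have hd : 0 < α.gcd r := Nat.gcd_pos_of_pos_right _ hr
    have hb0 : 0 < b := Nat.pos_of_mul_pos_left (hb ▸ hr)
    obtain ⟨v, hv⟩ := exists_pow_modEq_of_coprime hq hr2 (hyq.pow_left (m := b))
    obtain ⟨u, hup, huq⟩ : ∃ u : ℤ, u ≡ g ^ a [ZMOD (p : ℤ)] ∧ u ≡ v [ZMOD (q : ℤ)] := by
      have hc : IsCoprime (p : ℤ) (q : ℤ) :=
        Nat.isCoprime_iff_coprime.2 ((Nat.coprime_primes hp hq).2 hpq)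
      obtain ⟨s, t, hst⟩ := hc
      refine ⟨v * (s * p) + g ^ a * (t * q), ?_, ?_⟩
      · exact Int.modEq_iff_dvd.2 ⟨s * (g ^ a - v), by linear_combination (-g ^ a) * hst⟩
      · exact Int.modEq_iff_dvd.2 ⟨t * (v - g ^ a), by linear_combination (-v) * hst⟩
    have hyu : y ^ b ≡ u ^ r [ZMOD ((p * q : ℕ) : ℤ)] := by
      refine (hcrt _ _).2 ⟨?_, ((huq.pow r).trans hv).symm⟩
      refine (hα.pow b).trans ((hup.pow r).trans ?_).symm
      have : a * r = α * b := by
        calc a * r = a * (α.gcd r * b) := by rw [← hb]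
          _ = (α.gcd r * a) * b := by ring
          _ = α * b := by rw [← ha]
      rw [← pow_mul, ← pow_mul, this]
    have hu : IsCoprime u ((p * q : ℕ) : ℤ) := by
      have h1 : IsCoprime (u ^ r) ((p * q : ℕ) : ℤ) := by
        obtain ⟨c, hc⟩ := Int.modEq_iff_dvd.1 hyu
        rw [show u ^ r = y ^ b + ((p * q : ℕ) : ℤ) * c by linear_combination hc]
        exact (hy.pow_left (m := b)).add_mul_left_left c
      exact (IsCoprime.pow_left_iff hr).1 h1
    have hbr := h b 0 1 u isCoprime_one_left hu (by simpa using hyu)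
    have hle := Nat.le_of_dvd hb0 ((Nat.modEq_zero_iff_dvd).1 hbr)
    have : α.gcd r * b ≤ 1 * b := by rw [← hb]; simpa using hle
    exact le_antisymm (Nat.le_of_mul_le_mul_right this hb0) hd
  · have key : ∀ s : ℕ, s.Prime → s ∣ r →
        (y ^ ((p - 1) * (q - 1) / s) ≡ 1 [ZMOD ((p * q : ℕ) : ℤ)] ↔ s ∣ α) := by
      intro s hs hsr
      obtain ⟨c, hc⟩ := hsr.trans hrp
      have hc0 : 0 < c := Nat.pos_of_mul_pos_left (hc ▸ hp1)
      have hdiv : (p - 1) * (q - 1) / s = c * (q - 1) := by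
        rw [hc, mul_assoc, Nat.mul_div_cancel_left _ hs.pos]
      have hmodq : y ^ (c * (q - 1)) ≡ 1 [ZMOD (q : ℤ)] := by
        rw [mul_comm, pow_mul]
        simpa using (Int.ModEq.pow_card_sub_one_eq_one hq hyq).pow c
      have hsq : s.Coprime (q - 1) := hr2.coprime_dvd_left hsr
      have hmodp : y ^ (c * (q - 1)) ≡ 1 [ZMOD (p : ℤ)] ↔
          g ^ (α * (c * (q - 1))) ≡ g ^ 0 [ZMOD (p : ℤ)] := by
        have e := hα.pow (c * (q - 1))
        rw [← pow_mul] at e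
        rw [pow_zero]
        exact ⟨e.symm.trans, e.trans⟩
      rw [hdiv, hcrt, and_iff_left hmodq, hmodp, hpow, Nat.modEq_zero_iff_dvd, hc,
        show α * (c * (q - 1)) = α * (q - 1) * c by ring, Nat.mul_dvd_mul_iff_right hc0]
      exact hsq.dvd_mul_right
    constructor
    · intro h s hs hsr hy1
      exact Nat.not_coprime_of_dvd_of_dvd hs.one_lt ((key s hs hsr).1 hy1) hsr h
    · intro h
      exact Nat.coprime_of_dvd fun s hs hsα hsr ↦ h s hs hsr ((key s hs hsr).2 hsα)
end

section
/- Let p and q be distinct odd primes, n = pq, and let r be a positive integer with r ∣ p−1, gcd(r, (p−1)/r) = 1 and gcd(r, q−1) = 1. Let y be an integer coprime to n, g a primitive root modulo p, and α an integer with y ≡ g^α (mod p). If gcd(α, r) = 1, then decryption works unambiguously: for all integers m₁, m₂ and all integers u₁, u₂ coprime to n, y^{m₁}·u₁^r ≡ y^{m₂}·u₂^r (mod n) implies m₁ ≡ m₂ (mod r). -/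
/-- If the powers of an integer represent every residue class coprime to the odd prime `p`, then
that integer has multiplicative order `p - 1` modulo `p`. -/
theorem ZMod.orderOf_intCast_of_forall_exists_modEq_pow {p : ℕ} (hp : p.Prime) (hpodd : Odd p)
    {g : ℤ} (hg : ∀ z : ℤ, IsCoprime z (p : ℤ) → ∃ k : ℕ, z ≡ g ^ k [ZMOD (p : ℤ)]) :
    orderOf (g : ZMod p) = p - 1 := by
  have : Fact p.Prime := ⟨hp⟩
  have : Fact (2 < p) := ⟨hp.two_le.lt_of_ne (by rintro rfl; exact absurd hpodd (by decide))⟩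
  have hpow (z : (ZMod p)ˣ) : ∃ k : ℕ, (g : ZMod p) ^ k = z := by
    obtain ⟨a, ha⟩ := ZMod.intCast_surjective (z : ZMod p)
    obtain ⟨k, hk⟩ := hg a <| IsCoprime.symm <|
      (ZMod.coe_int_isUnit_iff_isCoprime a p).1 (ha ▸ z.isUnit)
    have hk := (ZMod.intCast_eq_intCast_iff _ _ _).2 hk
    push_cast at hk
    exact ⟨k, hk.symm.trans ha⟩
  have hg0 : (g : ZMod p) ≠ 0 := by
    intro h
    obtain ⟨k, hk⟩ := hpow (-1)
    rcases eq_or_ne k 0 with rfl | hk0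
    · exact ZMod.neg_one_ne_one (n := p) (by simpa using hk.symm)
    · simp [h, hk0] at hk
  have := orderOf_eq_card_of_forall_mem_powers (g := Units.mk0 _ hg0) fun z ↦ by
    obtain ⟨k, hk⟩ := hpow z
    exact ⟨k, Units.ext (by simpa using hk)⟩
  rw [← orderOf_units, Nat.card_eq_fintype_card, ZMod.card_units] at this
  simpa using this


theorem benaloh_coprime_implies_unambiguous (p q n : ℕ) (hp : p.Prime) (hq : q.Prime)
    (hpodd : Odd p) (hqodd : Odd q) (hpq : p ≠ q)
    (hn : n = p * q) (r : ℕ) (hr : 0 < r) (hrp : r ∣ p - 1)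
    (hr1 : Nat.Coprime r ((p - 1) / r)) (hr2 : Nat.Coprime r (q - 1)) (y : ℤ) (hy : IsCoprime y (n : ℤ))
    (g : ℤ)
    (hg : ∀ z : ℤ, IsCoprime z (p : ℤ) → ∃ k : ℕ, z ≡ g ^ k [ZMOD (p : ℤ)])
    (α : ℕ) (hα : y ≡ g ^ α [ZMOD (p : ℤ)])
    (hcop : Nat.Coprime α r) :
    ∀ (m₁ m₂ : ℕ) (u₁ u₂ : ℤ), IsCoprime u₁ (n : ℤ) → IsCoprime u₂ (n : ℤ) →
      y ^ m₁ * u₁ ^ r ≡ y ^ m₂ * u₂ ^ r [ZMOD (n : ℤ)] → m₁ ≡ m₂ [MOD r] := by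
  intro m₁ m₂ u₁ u₂ hu₁ hu₂ h
  have : Fact p.Prime := ⟨hp⟩
  have hord := ZMod.orderOf_intCast_of_forall_exists_modEq_pow hp hpodd hg
  have hpn : (p : ℤ) ∣ n := by simp [hn]
  have hα := (ZMod.intCast_eq_intCast_iff _ _ _).2 hα
  have h := (ZMod.intCast_eq_intCast_iff _ _ _).2 (h.of_dvd hpn)
  push_cast at hα h
  obtain ⟨s, hs⟩ := hrp
  have hs0 : s ≠ 0 := by
    rintro rfl
    have := hp.two_le
    omega
  have hpow_one {u : ℤ} (hu : IsCoprime u (n : ℤ)) : ((u : ZMod p) ^ r) ^ s = 1 := by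
    have hu' := (ZMod.coe_int_isUnit_iff_isCoprime u p).2 (hu.of_isCoprime_of_dvd_right hpn).symm
    rw [← pow_mul, ← hs, ZMod.pow_card_sub_one_eq_one hu'.ne_zero]
  have h' := congrArg (· ^ s) h
  simp only [mul_pow, hpow_one hu₁, hpow_one hu₂, mul_one, hα, ← pow_mul] at h'
  have hfin : IsOfFinOrder (g : ZMod p) := by
    rw [← orderOf_pos_iff, hord, hs]
    positivity
  have hmod : α * m₁ * s ≡ α * m₂ * s [MOD r * s] := by
    rw [← hs, ← hord]
    exact hfin.pow_eq_pow_iff_modEq.1 h'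
  exact (hmod.mul_right_cancel' hs0).cancel_left_of_coprime hcop.symm
end

section
/- Let p and q be distinct odd primes, n = pq, φ = (p−1)(q−1), and let r be a positive integer with r ∣ p−1, gcd(r, (p−1)/r) = 1 and gcd(r, q−1) = 1. Let y be an integer coprime to n, g a primitive root modulo p, and α an integer with y ≡ g^α (mod p). If gcd(α, r) = 1, then for every prime s dividing r one has y^{φ/s} ≢ 1 (mod n). -/
/-- If the powers of `g` exhaust the nonzero residues modulo an odd prime `p`, then `g` has
order `p - 1`. -/
theorem ZMod.orderOf_eq_sub_one_of_forall_eq_pow {p : ℕ} [Fact p.Prime] (hp : p ≠ 2) {g : ZMod p}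
    (hg : ∀ z : ZMod p, z ≠ 0 → ∃ k : ℕ, z = g ^ k) : orderOf g = p - 1 := by
  have : Fact (2 < p) := ⟨lt_of_le_of_ne (Fact.out : p.Prime).two_le hp.symm⟩
  have hg0 : g ≠ 0 := by
    rintro rfl
    obtain ⟨k, hk⟩ := hg (-1) (neg_ne_zero.mpr one_ne_zero)
    rcases k with _ | k
    · exact ZMod.neg_one_ne_one (by simpa using hk)
    · simp at hk
  have hgen : ∀ x : (ZMod p)ˣ, x ∈ Subgroup.zpowers (Units.mk0 g hg0) := by
    intro x
    obtain ⟨k, hk⟩ := hg x x.ne_zero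
    exact ⟨k, Units.ext (by simp [hk])⟩
  have hord := orderOf_eq_card_of_forall_mem_zpowers hgen
  rwa [Nat.card_eq_fintype_card, ZMod.card_units, ← orderOf_units, Units.val_mk0] at hord


theorem benaloh_coprime_implies_order_cond (p q n : ℕ) (hp : p.Prime) (hq : q.Prime)
    (hpodd : Odd p) (hqodd : Odd q) (hpq : p ≠ q)
    (hn : n = p * q) (φ : ℕ) (hφ : φ = (p - 1) * (q - 1)) (r : ℕ) (hr : 0 < r) (hrp : r ∣ p - 1)
    (hr1 : Nat.Coprime r ((p - 1) / r)) (hr2 : Nat.Coprime r (q - 1)) (y : ℤ) (hy : IsCoprime y (n : ℤ))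
    (g : ℤ)
    (hg : ∀ z : ℤ, IsCoprime z (p : ℤ) → ∃ k : ℕ, z ≡ g ^ k [ZMOD (p : ℤ)])
    (α : ℕ) (hα : y ≡ g ^ α [ZMOD (p : ℤ)])
    (hcop : Nat.Coprime α r) :
    ∀ s : ℕ, s.Prime → s ∣ r → ¬ (y ^ (φ / s) ≡ 1 [ZMOD (n : ℤ)]) := by
  intro s hs hsr hmod
  have : Fact p.Prime := ⟨hp⟩
  have hord : orderOf (g : ZMod p) = p - 1 := by
    refine ZMod.orderOf_eq_sub_one_of_forall_eq_pow (by rintro rfl; exact absurd hpodd (by decide))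
      fun z hz => ?_
    obtain ⟨z, rfl⟩ := ZMod.intCast_surjective z
    have hz' : IsCoprime z (p : ℤ) :=
      ((Nat.prime_iff_prime_int.mp hp).coprime_iff_not_dvd.mpr
        fun h => hz ((ZMod.intCast_zmod_eq_zero_iff_dvd z p).mpr h)).symm
    obtain ⟨k, hk⟩ := hg z hz'
    exact ⟨k, by simpa using (ZMod.intCast_eq_intCast_iff _ _ _).mpr hk⟩
  have hmodp : g ^ (α * (φ / s)) ≡ 1 [ZMOD (p : ℤ)] := by
    rw [pow_mul]
    exact (hα.symm.pow _).trans (hmod.of_dvd ⟨(q : ℤ), by simp [hn]⟩)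
  have hpow : (g : ZMod p) ^ (α * (φ / s)) = 1 := by
    simpa using (ZMod.intCast_eq_intCast_iff _ _ _).mpr hmodp
  obtain ⟨m, hm⟩ := hsr.trans hrp
  have hm0 : 0 < m := Nat.pos_of_ne_zero fun h => by
    have := hp.two_le
    simp [h] at hm
    omega
  have hdvd : s * m ∣ α * (q - 1) * m := by
    have h := orderOf_dvd_of_pow_eq_one hpow
    rw [hord, hφ, hm, mul_assoc, Nat.mul_div_cancel_left _ hs.pos] at h
    convert h using 1
    ring
  rcases hs.dvd_mul.mp (Nat.dvd_of_mul_dvd_mul_right hm0 hdvd) with h | h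
  · exact Nat.not_coprime_of_dvd_of_dvd hs.one_lt h hsr hcop
  · exact Nat.not_coprime_of_dvd_of_dvd hs.one_lt hsr h hr2
end

section
/- Let p and q be distinct odd primes, n = pq, φ = (p−1)(q−1), and let r be a positive integer with r ∣ p−1, gcd(r, (p−1)/r) = 1 and gcd(r, q−1) = 1. Let y be an integer coprime to n, g a primitive root modulo p, and α an integer with y ≡ g^α (mod p). If for every prime s dividing r one has y^{φ/s} ≢ 1 (mod n), then gcd(α, r) = 1. -/
theorem benaloh_order_cond_implies_coprime (p q n : ℕ) (hp : p.Prime) (hq : q.Prime)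
    (hpodd : Odd p) (hqodd : Odd q) (hpq : p ≠ q)
    (hn : n = p * q) (φ : ℕ) (hφ : φ = (p - 1) * (q - 1)) (r : ℕ) (hr : 0 < r) (hrp : r ∣ p - 1)
    (hr1 : Nat.Coprime r ((p - 1) / r)) (hr2 : Nat.Coprime r (q - 1)) (y : ℤ) (hy : IsCoprime y (n : ℤ))
    (g : ℤ)
    (hg : ∀ z : ℤ, IsCoprime z (p : ℤ) → ∃ k : ℕ, z ≡ g ^ k [ZMOD (p : ℤ)])
    (α : ℕ) (hα : y ≡ g ^ α [ZMOD (p : ℤ)])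
    (hcond : ∀ s : ℕ, s.Prime → s ∣ r → ¬ (y ^ (φ / s) ≡ 1 [ZMOD (n : ℤ)])) :
    Nat.Coprime α r := by
  refine Nat.coprime_of_dvd fun s hs hsα hsr => hcond s hs hsr ?_
  obtain ⟨a, rfl⟩ := hsα
  obtain ⟨m, hm⟩ := hsr.trans hrp
  have hφs : φ / s = m * (q - 1) := by
    rw [hφ, hm, mul_assoc, Nat.mul_div_cancel_left _ hs.pos]
  rw [hn, Nat.cast_mul] at hy ⊢
  rw [hφs]
  rw [← Int.modEq_and_modEq_iff_modEq_mul (by simpa using (Nat.coprime_primes hp hq).2 hpq)]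
  constructor
  · have hga : IsCoprime (g ^ a) (p : ℤ) := by
      have hpow : IsCoprime ((g ^ a) ^ s) (p : ℤ) := by
        obtain ⟨k, hk⟩ := hα.dvd
        rw [← pow_mul, mul_comm a s, eq_add_of_sub_eq' hk]
        exact hy.of_mul_right_left.add_mul_left_left k
      exact (IsCoprime.pow_left_iff hs.pos).1 hpow
    calc y ^ (m * (q - 1)) ≡ (g ^ (s * a)) ^ (m * (q - 1)) [ZMOD p] := hα.pow _
      _ = ((g ^ a) ^ (p - 1)) ^ (q - 1) := by
        rw [hm]; ring
      _ ≡ 1 ^ (q - 1) [ZMOD p] := (Int.ModEq.pow_card_sub_one_eq_one hp hga).pow _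
      _ = 1 := one_pow _
  · rw [mul_comm m, pow_mul]
    simpa using (Int.ModEq.pow_card_sub_one_eq_one hq hy.of_mul_right_right).pow m
end

section
/- Let p and q be distinct odd primes, n = pq, and let r be a positive integer with r ∣ p−1, gcd(r, (p−1)/r) = 1 and gcd(r, q−1) = 1. Let y be an integer coprime to n, g a primitive root modulo p, and α an integer with y ≡ g^α (mod p). If decryption works unambiguously (for all integers m₁, m₂ and all integers u₁, u₂ coprime to n, y^{m₁}·u₁^r ≡ y^{m₂}·u₂^r (mod n) implies m₁ ≡ m₂ (mod r)), then gcd(α, r) = 1. -/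
theorem exists_int_modEq_of_isCoprime {m n : ℤ} (h : IsCoprime m n) (a b : ℤ) :
    ∃ u : ℤ, u ≡ a [ZMOD m] ∧ u ≡ b [ZMOD n] := by
  obtain ⟨x, z, hxz⟩ := h
  refine ⟨a * z * n + b * x * m, ?_, ?_⟩
  · refine Int.modEq_iff_dvd.2 ⟨(a - b) * x, ?_⟩
    linear_combination (-a) * hxz
  · refine Int.modEq_iff_dvd.2 ⟨(b - a) * z, ?_⟩
    linear_combination (-b) * hxz

theorem exists_pow_mul_modEq_self_of_coprime {q r : ℕ} (hq : q.Prime) (hqodd : Odd q)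
    (hr : Nat.Coprime r (q - 1)) :
    ∃ t : ℕ, ∀ x : ℤ, IsCoprime x (q : ℤ) → (x ^ t) ^ r ≡ x [ZMOD (q : ℤ)] := by
  have hq2 : 1 < q - 1 := by
    have := hq.two_le
    obtain ⟨k, rfl⟩ := hqodd
    omega
  obtain ⟨t, -, ht⟩ := Nat.exists_mul_mod_eq_one_of_coprime hr hq2
  refine ⟨t, fun x hx => ?_⟩
  have hrt : t * r = (q - 1) * (r * t / (q - 1)) + 1 := by
    have := Nat.div_add_mod (r * t) (q - 1)
    rw [ht] at this
    rw [mul_comm t r, this]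
  rw [← pow_mul, hrt, pow_succ, pow_mul]
  simpa using ((Int.ModEq.pow_card_sub_one_eq_one hq hx).pow (r * t / (q - 1))).mul_right x

theorem benaloh_unambiguous_implies_coprime (p q n : ℕ) (hp : p.Prime) (hq : q.Prime)
    (hpodd : Odd p) (hqodd : Odd q) (hpq : p ≠ q)
    (hn : n = p * q) (r : ℕ) (hr : 0 < r) (hrp : r ∣ p - 1)
    (hr1 : Nat.Coprime r ((p - 1) / r)) (hr2 : Nat.Coprime r (q - 1)) (y : ℤ) (hy : IsCoprime y (n : ℤ))
    (g : ℤ)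
    (hg : ∀ z : ℤ, IsCoprime z (p : ℤ) → ∃ k : ℕ, z ≡ g ^ k [ZMOD (p : ℤ)])
    (α : ℕ) (hα : y ≡ g ^ α [ZMOD (p : ℤ)])
    (hdec : ∀ (m₁ m₂ : ℕ) (u₁ u₂ : ℤ), IsCoprime u₁ (n : ℤ) → IsCoprime u₂ (n : ℤ) →
      y ^ m₁ * u₁ ^ r ≡ y ^ m₂ * u₂ ^ r [ZMOD (n : ℤ)] → m₁ ≡ m₂ [MOD r]) :
    Nat.Coprime α r := by
  subst hn
  push_cast at hy hdec
  obtain ⟨a, ha⟩ := Nat.gcd_dvd_left α r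
  obtain ⟨s, hs⟩ := Nat.gcd_dvd_right α r
  have hpq' : IsCoprime (p : ℤ) (q : ℤ) :=
    Nat.isCoprime_iff_coprime.2 ((Nat.coprime_primes hp hq).2 hpq)
  obtain ⟨t, ht⟩ := exists_pow_mul_modEq_self_of_coprime hq hqodd hr2
  obtain ⟨u, hup, huq⟩ := exists_int_modEq_of_isCoprime hpq' (g ^ a) ((y ^ s) ^ t)
  have hp' : y ^ s ≡ u ^ r [ZMOD (p : ℤ)] := by
    have hexp : α * s = a * r := by
      calc α * s = α.gcd r * a * s := by rw [← ha]
        _ = a * (α.gcd r * s) := by ring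
        _ = a * r := by rw [← hs]
    calc y ^ s ≡ (g ^ α) ^ s [ZMOD (p : ℤ)] := hα.pow s
      _ = (g ^ a) ^ r := by rw [← pow_mul, ← pow_mul, hexp]
      _ ≡ u ^ r [ZMOD (p : ℤ)] := (hup.pow r).symm
  have hq' : y ^ s ≡ u ^ r [ZMOD (q : ℤ)] :=
    (ht (y ^ s) hy.of_mul_right_right.pow_left).symm.trans (huq.pow r).symm
  have hpow : y ^ s ≡ u ^ r [ZMOD (p : ℤ) * q] :=
    Int.modEq_iff_dvd.2 (hpq'.mul_dvd (Int.modEq_iff_dvd.1 hp') (Int.modEq_iff_dvd.1 hq'))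
  have hu : IsCoprime u ((p : ℤ) * q) := by
    obtain ⟨c, hc⟩ := Int.modEq_iff_dvd.1 hpow
    rw [← IsCoprime.pow_left_iff hr, sub_eq_iff_eq_add'.1 hc]
    exact (hy.pow_left (m := s)).add_mul_left_left c
  have hrs : r ∣ s := (Nat.modEq_zero_iff_dvd).1
    (hdec s 0 1 u isCoprime_one_left hu (by simpa using hpow))
  have hs0 : 0 < s := Nat.pos_of_ne_zero (by rintro rfl; omega)
  have hle := Nat.le_of_dvd hs0 hrs
  have hd : 0 < α.gcd r := Nat.gcd_pos_of_pos_right α hr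
  change α.gcd r = 1
  nlinarith
end

section
/- Let p and q be distinct odd primes, n = pq, and let r be a positive integer with r ∣ p−1, gcd(r, (p−1)/r) = 1 and gcd(r, q−1) = 1. Let y be an integer coprime to n, g a primitive root modulo p, and α an integer with y ≡ g^α (mod p). If m₁, m₂ are integers and u₁, u₂ are integers coprime to n such that y^{m₁}·u₁^r ≡ y^{m₂}·u₂^r (mod n), then α·(m₁ − m₂) ≡ 0 (mod r). -/
theorem benaloh_key_congruence (p q n : ℕ) (hp : p.Prime) (hq : q.Prime)
    (hpodd : Odd p) (hqodd : Odd q) (hpq : p ≠ q)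
    (hn : n = p * q) (r : ℕ) (hr : 0 < r) (hrp : r ∣ p - 1)
    (hr1 : Nat.Coprime r ((p - 1) / r)) (hr2 : Nat.Coprime r (q - 1)) (y : ℤ) (hy : IsCoprime y (n : ℤ))
    (g : ℤ)
    (hg : ∀ z : ℤ, IsCoprime z (p : ℤ) → ∃ k : ℕ, z ≡ g ^ k [ZMOD (p : ℤ)])
    (α : ℕ) (hα : y ≡ g ^ α [ZMOD (p : ℤ)])
    (m₁ m₂ : ℕ) (u₁ u₂ : ℤ) (hu₁ : IsCoprime u₁ (n : ℤ)) (hu₂ : IsCoprime u₂ (n : ℤ))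
    (henc : y ^ m₁ * u₁ ^ r ≡ y ^ m₂ * u₂ ^ r [ZMOD (n : ℤ)]) :
    (α : ℤ) * ((m₁ : ℤ) - (m₂ : ℤ)) ≡ 0 [ZMOD (r : ℤ)] := by
  have : Fact p.Prime := ⟨hp⟩
  have hp2 : (2 : ℕ) < p := by
    have := hp.two_le
    obtain ⟨t, rfl⟩ := hpodd
    omega
  have : Fact (2 < p) := ⟨hp2⟩
  have hpn : (p : ℤ) ∣ n := by exact_mod_cast (⟨q, hn⟩ : p ∣ n)
  obtain ⟨s, hs⟩ := hrp
  have hs0 : s ≠ 0 := by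
    rintro rfl
    omega
  have hg' (z : (ZMod p)ˣ) : ∃ k : ℕ, (z : ZMod p) = (g : ZMod p) ^ k := by
    obtain ⟨k, hk⟩ := hg (z.val.val : ℤ) (Nat.isCoprime_iff_coprime.2 (ZMod.val_coe_unit_coprime z))
    refine ⟨k, ?_⟩
    simpa using (ZMod.intCast_eq_intCast_iff _ _ p).2 hk
  have hg0 : (g : ZMod p) ≠ 0 := by
    intro h
    obtain ⟨k, hk⟩ := hg' (-1)
    rcases k with _ | k
    · exact ZMod.neg_one_ne_one (by simpa using hk)
    · simp [h] at hk
  have hord : orderOf (Units.mk0 (g : ZMod p) hg0) = r * s := by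
    rw [orderOf_eq_card_of_forall_mem_zpowers, Nat.card_eq_fintype_card, ZMod.card_units, hs]
    intro z
    obtain ⟨k, hk⟩ := hg' z
    exact ⟨k, Units.ext (by simp [hk])⟩
  have hpow (u : ℤ) (hu : IsCoprime u (n : ℤ)) : ((u : ZMod p) ^ r) ^ s = 1 := by
    rw [← pow_mul, ← hs]
    refine ZMod.pow_card_sub_one_eq_one fun h => ?_
    have hdvd := (ZMod.intCast_zmod_eq_zero_iff_dvd u p).1 h
    exact (Nat.prime_iff_prime_int.1 hp).not_isUnit (hu.isUnit_of_dvd' hdvd hpn)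
  have hyp : (y : ZMod p) = (g : ZMod p) ^ α := by
    simpa using (ZMod.intCast_eq_intCast_iff _ _ p).2 hα
  have henc' : (y : ZMod p) ^ m₁ * (u₁ : ZMod p) ^ r = (y : ZMod p) ^ m₂ * (u₂ : ZMod p) ^ r := by
    simpa using (ZMod.intCast_eq_intCast_iff _ _ p).2 (henc.of_dvd hpn)
  have hgpow : (g : ZMod p) ^ (α * m₁ * s) = (g : ZMod p) ^ (α * m₂ * s) := by
    have h := congrArg (· ^ s) henc'
    simp only [mul_pow, hpow u₁ hu₁, hpow u₂ hu₂, mul_one, hyp] at h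
    simpa only [← pow_mul] using h
  have hmod : α * m₁ * s ≡ α * m₂ * s [MOD r * s] := by
    rw [← hord, ← pow_eq_pow_iff_modEq]
    exact Units.ext (by simpa using hgpow)
  have hmod' : (α * m₁ : ℤ) ≡ α * m₂ [ZMOD r] := by
    exact_mod_cast (Nat.ModEq.mul_right_cancel' hs0 hmod)
  simpa [mul_sub] using hmod'.sub_right (α * m₂ : ℤ)
end

section
/- Let p and q be distinct odd primes, n = pq, φ = (p−1)(q−1), and let r be a positive integer with r ∣ p−1, gcd(r, (p−1)/r) = 1 and gcd(r, q−1) = 1. Let y be an integer coprime to n, g a primitive root modulo p, and α an integer with y ≡ g^α (mod p). Then y^{φ/r} ≢ 1 (mod n) if and only if r does not divide α. -/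
theorem ZMod.orderOf_intCast_eq_sub_one_of_forall_exists_pow {p : ℕ} [Fact p.Prime]
    (hpodd : Odd p) {g : ℤ}
    (hg : ∀ z : ℤ, IsCoprime z (p : ℤ) → ∃ k : ℕ, z ≡ g ^ k [ZMOD (p : ℤ)]) :
    orderOf (g : ZMod p) = p - 1 := by
  have hg' : ∀ x : (ZMod p)ˣ, ∃ k : ℕ, (x : ZMod p) = (g : ZMod p) ^ k := by
    intro x
    obtain ⟨z, hz⟩ := ZMod.intCast_surjective (x : ZMod p)
    have hcop : IsCoprime z (p : ℤ) :=
      ((ZMod.coe_int_isUnit_iff_isCoprime z p).1 (hz ▸ x.isUnit)).symm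
    obtain ⟨k, hk⟩ := hg z hcop
    refine ⟨k, ?_⟩
    rw [← hz]
    exact_mod_cast (ZMod.intCast_eq_intCast_iff z (g ^ k) p).2 hk
  have hunit : IsUnit (g : ZMod p) := by
    obtain ⟨k, hk⟩ := hg' (-1)
    have : Fact (2 < p) := ⟨by
      have := (Fact.out : p.Prime).two_le
      obtain ⟨m, rfl⟩ := hpodd
      omega⟩
    have hk0 : k ≠ 0 := by
      rintro rfl
      exact ZMod.neg_one_ne_one (by simpa using hk)
    rw [← isUnit_pow_iff hk0, ← hk]
    exact Units.isUnit _
  obtain ⟨u, hu⟩ := hunit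
  rw [← hu, orderOf_units, ← ZMod.card_units p, ← Nat.card_eq_fintype_card]
  refine orderOf_eq_card_of_forall_mem_zpowers fun x => ?_
  obtain ⟨k, hk⟩ := hg' x
  refine ⟨k, Units.ext ?_⟩
  simp [hk, hu]

theorem benaloh_original_condition_iff (p q n : ℕ) (hp : p.Prime) (hq : q.Prime)
    (hpodd : Odd p) (hqodd : Odd q) (hpq : p ≠ q)
    (hn : n = p * q) (φ : ℕ) (hφ : φ = (p - 1) * (q - 1)) (r : ℕ) (hr : 0 < r) (hrp : r ∣ p - 1)
    (hr1 : Nat.Coprime r ((p - 1) / r)) (hr2 : Nat.Coprime r (q - 1)) (y : ℤ) (hy : IsCoprime y (n : ℤ))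
    (g : ℤ)
    (hg : ∀ z : ℤ, IsCoprime z (p : ℤ) → ∃ k : ℕ, z ≡ g ^ k [ZMOD (p : ℤ)])
    (α : ℕ) (hα : y ≡ g ^ α [ZMOD (p : ℤ)]) :
    ¬ (y ^ (φ / r) ≡ 1 [ZMOD (n : ℤ)]) ↔ ¬ (r ∣ α) := by
  have : Fact p.Prime := ⟨hp⟩
  have : Fact q.Prime := ⟨hq⟩
  have hord := ZMod.orderOf_intCast_eq_sub_one_of_forall_exists_pow hpodd hg
  obtain ⟨s, hs⟩ := hrp
  have hs0 : 0 < s := Nat.pos_of_ne_zero fun h => by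
    have := hp.two_le
    simp only [h, mul_zero] at hs
    omega
  have hexp : φ / r = s * (q - 1) := by
    rw [hφ, hs, mul_assoc, Nat.mul_div_cancel_left _ hr]
  have hyq : y ^ (φ / r) ≡ 1 [ZMOD (q : ℤ)] := by
    have hcop : IsCoprime y (q : ℤ) := by
      rw [hn, Nat.cast_mul] at hy
      exact hy.of_mul_right_right
    rw [hexp, mul_comm, pow_mul]
    simpa using (Int.ModEq.pow_card_sub_one_eq_one hq hcop).pow s
  have hcrt : y ^ (φ / r) ≡ 1 [ZMOD (n : ℤ)] ↔ y ^ (φ / r) ≡ 1 [ZMOD (p : ℤ)] := by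
    rw [hn, Nat.cast_mul, ← Int.modEq_and_modEq_iff_modEq_mul
      (by simpa using (Nat.coprime_primes hp hq).2 hpq)]
    exact and_iff_left hyq
  have hyg : (y : ZMod p) = (g : ZMod p) ^ α := by
    exact_mod_cast (ZMod.intCast_eq_intCast_iff y (g ^ α) p).2 hα
  rw [not_iff_not, hcrt, ← ZMod.intCast_eq_intCast_iff, Int.cast_pow, Int.cast_one, hyg, ← pow_mul,
    ← orderOf_dvd_iff_pow_eq_one, hord, hs, hexp,
    show α * (s * (q - 1)) = α * (q - 1) * s by ring, Nat.mul_dvd_mul_iff_right hs0]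
  exact hr2.dvd_mul_right
end

section
/- Let p and q be distinct odd primes, n = pq, φ = (p−1)(q−1), and let r be a positive integer with r ∣ p−1, gcd(r, (p−1)/r) = 1 and gcd(r, q−1) = 1. Then the number of residues y modulo n that are coprime to n and satisfy y^{φ/r} ≡ 1 (mod n) equals φ(n)/r, where φ(n) = (p−1)(q−1); equivalently, the number of y in (ℤ/nℤ)ˣ satisfying Benaloh's original condition y^{φ/r} ≢ 1 (mod n) equals ((r−1)/r)·(p−1)(q−1). -/
/-- In a finite cyclic group `G`, the equation `y ^ d = 1` has `gcd (card G) d` solutions. -/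
theorem card_pow_eq_one_of_isCyclic {G : Type*} [CommGroup G] [IsCyclic G] [Finite G] (d : ℕ) :
    Nat.card {y : G // y ^ d = 1} = (Nat.card G).gcd d :=
  IsCyclic.card_powMonoidHom_ker G d

/-- For distinct primes `p` and `q`, the number of solutions of `y ^ k = 1` in the units modulo
`p * q`. -/
theorem card_units_zmod_prime_mul_pow_eq_one {p q : ℕ} (hp : p.Prime) (hq : q.Prime)
    (hpq : p ≠ q) (k : ℕ) :
    Nat.card {y : (ZMod (p * q))ˣ // y ^ k = 1} = (p - 1).gcd k * (q - 1).gcd k := by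
  have : Fact p.Prime := ⟨hp⟩
  have : Fact q.Prime := ⟨hq⟩
  let e : (ZMod (p * q))ˣ ≃* (ZMod p)ˣ × (ZMod q)ˣ :=
    (Units.mapEquiv
      (ZMod.chineseRemainder ((Nat.coprime_primes hp hq).2 hpq)).toMulEquiv).trans
      MulEquiv.prodUnits
  have e' : {y : (ZMod (p * q))ˣ // y ^ k = 1} ≃
      {y : (ZMod p)ˣ // y ^ k = 1} × {y : (ZMod q)ˣ // y ^ k = 1} :=
    (e.toEquiv.subtypeEquiv fun y ↦ by
      change y ^ k = 1 ↔ (e y).1 ^ k = 1 ∧ (e y).2 ^ k = 1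
      rw [← e.map_eq_one_iff, map_pow, Prod.ext_iff]
      rfl).trans Equiv.subtypeProdEquivProd
  rw [Nat.card_congr e', Nat.card_prod, card_pow_eq_one_of_isCyclic, card_pow_eq_one_of_isCyclic,
    Nat.card_eq_fintype_card, Nat.card_eq_fintype_card, ZMod.card_units, ZMod.card_units]

theorem benaloh_count_original_condition (p q n : ℕ) (hp : p.Prime) (hq : q.Prime)
    (hpodd : Odd p) (hqodd : Odd q) (hpq : p ≠ q)
    (hn : n = p * q) (φ : ℕ) (hφ : φ = (p - 1) * (q - 1)) (r : ℕ) (hr : 0 < r) (hrp : r ∣ p - 1)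
    (hr1 : Nat.Coprime r ((p - 1) / r)) (hr2 : Nat.Coprime r (q - 1)) :
    Nat.card {y : (ZMod n)ˣ // y ^ (φ / r) = 1} = (p - 1) * (q - 1) / r ∧
    Nat.card {y : (ZMod n)ˣ // y ^ (φ / r) ≠ 1} = (r - 1) * ((p - 1) * (q - 1) / r) := by
  subst hn hφ
  obtain ⟨m, hm⟩ := hrp
  have hk : (p - 1) * (q - 1) / r = m * (q - 1) := by
    rw [hm, mul_assoc, Nat.mul_div_cancel_left _ hr]
  have h_one : Nat.card {y : (ZMod (p * q))ˣ // y ^ (m * (q - 1)) = 1} = m * (q - 1) := by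
    rw [card_units_zmod_prime_mul_pow_eq_one hp hq hpq, hm, mul_comm r m, Nat.gcd_mul_left,
      hr2.gcd_eq_one, mul_one, Nat.gcd_mul_left_right]
  have : NeZero (p * q) := ⟨mul_ne_zero hp.ne_zero hq.ne_zero⟩
  have h_total : Nat.card (ZMod (p * q))ˣ = r * (m * (q - 1)) := by
    rw [Nat.card_eq_fintype_card, ZMod.card_units_eq_totient,
      Nat.totient_mul ((Nat.coprime_primes hp hq).2 hpq), Nat.totient_prime hp,
      Nat.totient_prime hq, hm, mul_assoc]
  rw [hk]
  refine ⟨h_one, ?_⟩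
  classical
  have h_compl := Fintype.card_subtype_compl fun y : (ZMod (p * q))ˣ ↦ y ^ (m * (q - 1)) = 1
  simp only [← Nat.card_eq_fintype_card] at h_compl
  rw [h_compl, h_one, h_total, Nat.sub_mul, one_mul]
end

section
/- Let p and q be distinct odd primes, n = pq, and let r be a positive integer with r ∣ p−1, gcd(r, (p−1)/r) = 1 and gcd(r, q−1) = 1. Let y be an integer coprime to n, g a primitive root modulo p, and α an integer with y ≡ g^α (mod p). Set u = gcd(α, r). Then for all integers m₁, m₂, there exist integers u₁, u₂ coprime to n with y^{m₁}·u₁^r ≡ y^{m₂}·u₂^r (mod n) if and only if m₁ ≡ m₂ (mod r/u). In particular the actual cleartext space size is r' = r/u. -/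
/-- Chinese remainder theorem for integers, keeping coprimality to both moduli. -/
theorem Int.exists_modEq_and_modEq_of_isCoprime {p q a b : ℤ} (h : IsCoprime p q)
    (ha : IsCoprime a p) (hb : IsCoprime b q) :
    ∃ x : ℤ, x ≡ a [ZMOD p] ∧ x ≡ b [ZMOD q] ∧ IsCoprime x (p * q) := by
  obtain ⟨s, t, hst⟩ := h
  have h1 : a * (t * q) + b * (s * p) = a + p * (s * (b - a)) := by
    linear_combination a * hst
  have h2 : a * (t * q) + b * (s * p) = b + q * (t * (a - b)) := by
    linear_combination b * hst
  refine ⟨a * (t * q) + b * (s * p), ?_, ?_, IsCoprime.mul_right ?_ ?_⟩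
  · rw [h1]
    simp [Int.ModEq]
  · rw [h2]
    simp [Int.ModEq]
  · rw [h1]
    exact (IsCoprime.add_mul_left_left_iff).2 ha
  · rw [h2]
    exact (IsCoprime.add_mul_left_left_iff).2 hb

/-- Exponents of a primitive root modulo `p` are determined modulo `p - 1`. -/
theorem Int.modEq_of_primitiveRoot_pow_modEq {p : ℕ} (hp : p.Prime) {g : ℤ}
    (hgp : IsCoprime g (p : ℤ))
    (hg : ∀ z : ℤ, IsCoprime z (p : ℤ) → ∃ k : ℕ, z ≡ g ^ k [ZMOD (p : ℤ)])
    {a b : ℕ} (hab : g ^ a ≡ g ^ b [ZMOD (p : ℤ)]) : a ≡ b [MOD p - 1] := by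
  have := Fact.mk hp
  let G : (ZMod p)ˣ := ZMod.unitOfIsCoprime g hgp
  have hG : (G : ZMod p) = (g : ZMod p) := ZMod.coe_unitOfIsCoprime g hgp
  have hord : orderOf G = p - 1 := by
    rw [← ZMod.card_units p, ← Nat.card_eq_fintype_card]
    refine orderOf_eq_card_of_forall_mem_zpowers fun x => ?_
    obtain ⟨z, hz⟩ := ZMod.intCast_surjective (x : ZMod p)
    have hzc : IsCoprime z (p : ℤ) := by
      rw [isCoprime_comm, ← ZMod.coe_int_isUnit_iff_isCoprime, hz]
      exact x.isUnit
    obtain ⟨k, hk⟩ := hg z hzc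
    refine ⟨k, Units.ext ?_⟩
    have := (ZMod.intCast_eq_intCast_iff _ _ p).2 hk
    push_cast at this
    simp [hG, ← this, hz]
  rw [← hord, ← pow_eq_pow_iff_modEq]
  refine Units.ext ?_
  have := (ZMod.intCast_eq_intCast_iff _ _ p).2 hab
  push_cast at this
  simpa [hG] using this

theorem Int.isCoprime_of_primitiveRoot {p : ℕ} (hp : p.Prime) (hpodd : Odd p) {g : ℤ}
    (hg : ∀ z : ℤ, IsCoprime z (p : ℤ) → ∃ k : ℕ, z ≡ g ^ k [ZMOD (p : ℤ)]) :
    IsCoprime g (p : ℤ) := by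
  obtain ⟨k, hk⟩ := hg (-1) isCoprime_one_left.neg_left
  have hc : IsCoprime (g ^ k) (p : ℤ) := by
    obtain ⟨c, hc⟩ := hk.dvd
    rw [show g ^ k = -1 + p * c by linarith]
    exact (IsCoprime.add_mul_left_left_iff).2 isCoprime_one_left.neg_left
  rcases Nat.eq_zero_or_pos k with rfl | hk0
  · obtain ⟨c, hc⟩ := hk.dvd
    have h2 : (p : ℤ) ∣ 2 := ⟨c, by linarith⟩
    have h2' : p ∣ 2 := by exact_mod_cast h2
    rw [(Nat.prime_dvd_prime_iff_eq hp Nat.prime_two).1 h2'] at hpodd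
    exact absurd hpodd (by decide)
  · exact (IsCoprime.pow_left_iff hk0).1 hc

/-- Modulo a prime `p`, with `r ∣ p - 1`, the exponent of a primitive root is determined
modulo `r` up to multiplication by `r`-th powers. -/
theorem Int.modEq_of_primitiveRoot_pow_mul_pow_modEq {p : ℕ} (hp : p.Prime) {g : ℤ}
    (hgp : IsCoprime g (p : ℤ))
    (hg : ∀ z : ℤ, IsCoprime z (p : ℤ) → ∃ k : ℕ, z ≡ g ^ k [ZMOD (p : ℤ)])
    {r : ℕ} (hrp : r ∣ p - 1) {a b : ℕ} {u v : ℤ} (hu : IsCoprime u (p : ℤ))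
    (hv : IsCoprime v (p : ℤ)) (h : g ^ a * u ^ r ≡ g ^ b * v ^ r [ZMOD (p : ℤ)]) :
    a ≡ b [MOD r] := by
  obtain ⟨k, hk⟩ := hg u hu
  obtain ⟨l, hl⟩ := hg v hv
  have h1 : g ^ (a + k * r) ≡ g ^ (b + l * r) [ZMOD (p : ℤ)] := by
    rw [pow_add, pow_add, pow_mul, pow_mul]
    exact (((hk.pow r).symm.mul_left _).trans h).trans ((hl.pow r).mul_left _)
  simpa [Nat.ModEq] using (Int.modEq_of_primitiveRoot_pow_modEq hp hgp hg h1).of_dvd hrp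

theorem Nat.mul_modEq_mul_iff_modEq_div_gcd {a r m₁ m₂ : ℕ} (hr : 0 < r) :
    a * m₁ ≡ a * m₂ [MOD r] ↔ m₁ ≡ m₂ [MOD r / Nat.gcd a r] := by
  constructor
  · intro h
    rw [Nat.gcd_comm]
    exact h.cancel_left_div_gcd hr
  · intro h
    have h1 := h.mul_left' a
    refine h1.of_dvd ?_
    rw [← Nat.mul_div_assoc _ (Nat.gcd_dvd_right a r), Nat.mul_comm,
      Nat.mul_div_assoc _ (Nat.gcd_dvd_left a r)]
    exact dvd_mul_right _ _

/-- If `r` is coprime to `q - 1`, every unit modulo the prime `q` is an `r`-th power. -/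
theorem Int.exists_pow_modEq_of_coprime_sub_one {q : ℕ} (hq : q.Prime) (hqodd : Odd q) {r : ℕ}
    (hr : Nat.Coprime r (q - 1)) {y : ℤ} (hy : IsCoprime y (q : ℤ)) :
    ∃ z : ℤ, IsCoprime z (q : ℤ) ∧ z ^ r ≡ y [ZMOD (q : ℤ)] := by
  have h3 : 1 < q - 1 := by
    obtain ⟨c, rfl⟩ := hqodd
    have := hq.two_le
    omega
  obtain ⟨s, hs⟩ := Nat.exists_mul_mod_eq_one_of_coprime hr h3
  refine ⟨y ^ s, hy.pow_left, ?_⟩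
  have hdm := Nat.div_add_mod (r * s) (q - 1)
  rw [hs.2] at hdm
  rw [← pow_mul, Nat.mul_comm, ← hdm, pow_add, pow_mul, pow_one]
  simpa using ((Int.ModEq.pow_card_sub_one_eq_one hq hy).pow _).mul_right y


theorem benaloh_actual_cleartext_space (p q n : ℕ) (hp : p.Prime) (hq : q.Prime)
    (hpodd : Odd p) (hqodd : Odd q) (hpq : p ≠ q)
    (hn : n = p * q) (r : ℕ) (hr : 0 < r) (hrp : r ∣ p - 1)
    (hr1 : Nat.Coprime r ((p - 1) / r)) (hr2 : Nat.Coprime r (q - 1)) (y : ℤ) (hy : IsCoprime y (n : ℤ))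
    (g : ℤ)
    (hg : ∀ z : ℤ, IsCoprime z (p : ℤ) → ∃ k : ℕ, z ≡ g ^ k [ZMOD (p : ℤ)])
    (α : ℕ) (hα : y ≡ g ^ α [ZMOD (p : ℤ)]) :
    ∀ m₁ m₂ : ℕ,
      (∃ u₁ u₂ : ℤ, IsCoprime u₁ (n : ℤ) ∧ IsCoprime u₂ (n : ℤ) ∧
        y ^ m₁ * u₁ ^ r ≡ y ^ m₂ * u₂ ^ r [ZMOD (n : ℤ)]) ↔
      m₁ ≡ m₂ [MOD r / Nat.gcd α r] := by
  subst hn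
  push_cast at hy ⊢
  have hyp : IsCoprime y (p : ℤ) := hy.of_mul_right_left
  have hyq : IsCoprime y (q : ℤ) := hy.of_mul_right_right
  have hpq' : IsCoprime (p : ℤ) (q : ℤ) :=
    Nat.isCoprime_iff_coprime.2 ((Nat.coprime_primes hp hq).2 hpq)
  have hgp := Int.isCoprime_of_primitiveRoot hp hpodd hg
  have hyg (m : ℕ) : y ^ m ≡ g ^ (α * m) [ZMOD (p : ℤ)] := by
    rw [pow_mul]
    exact hα.pow m
  intro m₁ m₂
  rw [← Nat.mul_modEq_mul_iff_modEq_div_gcd hr]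
  constructor
  · rintro ⟨u, v, hu, hv, h⟩
    refine Int.modEq_of_primitiveRoot_pow_mul_pow_modEq hp hgp hg hrp hu.of_mul_right_left
      hv.of_mul_right_left ?_
    exact (((hyg m₁).mul_right _).symm.trans (h.of_dvd (dvd_mul_right _ _))).trans
      ((hyg m₂).mul_right _)
  · intro h
    obtain ⟨z, hz, hzy⟩ := Int.exists_pow_modEq_of_coprime_sub_one hq hqodd hr2 hyq
    obtain ⟨u, hup, huq, hu⟩ := Int.exists_modEq_and_modEq_of_isCoprime hpq'
      (hgp.pow_left (m := α * m₂ / r)) (hz.pow_left (m := m₂))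
    obtain ⟨v, hvp, hvq, hv⟩ := Int.exists_modEq_and_modEq_of_isCoprime hpq'
      (hgp.pow_left (m := α * m₁ / r)) (hz.pow_left (m := m₁))
    refine ⟨u, v, hu, hv, ?_⟩
    rw [← Int.modEq_and_modEq_iff_modEq_mul (by simpa using (Nat.coprime_primes hp hq).2 hpq)]
    constructor
    · refine ((hyg m₁).mul (hup.pow r)).trans (.trans ?_ ((hyg m₂).mul (hvp.pow r)).symm)
      rw [← pow_mul, ← pow_mul, ← pow_add, ← pow_add]
      have h1 := Nat.div_add_mod (α * m₁) r
      have h2 := Nat.div_add_mod (α * m₂) r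
      have h3 : α * m₁ % r = α * m₂ % r := h
      have h4 : α * m₁ + α * m₂ / r * r = α * m₂ + α * m₁ / r * r := by
        rw [Nat.mul_comm _ r, Nat.mul_comm _ r]
        omega
      rw [h4]
    · have hpow (m : ℕ) : (z ^ m) ^ r ≡ y ^ m [ZMOD (q : ℤ)] := by
        rw [pow_right_comm]
        exact hzy.pow m
      refine (((huq.pow r).trans (hpow m₂)).mul_left _).trans ?_
      rw [mul_comm]
      exact (((hvq.pow r).trans (hpow m₁)).mul_left _).symm
end

section
/- Let p and q be distinct odd primes, n = pq, φ = (p−1)(q−1), and let r be a positive integer with r ∣ p−1, gcd(r, (p−1)/r) = 1 and gcd(r, q−1) = 1. Let y be an integer coprime to n, g a primitive root modulo p, and α an integer with y ≡ g^α (mod p) such that gcd(α, r) = 1 (a valid parameter). If u is a divisor of r with 1 < u < r, then y' = y^u mod n is an undetected faulty parameter: y' satisfies y'^{φ/r} ≢ 1 (mod n), and the gcd with r of the discrete logarithm of y' modulo p equals u, so the actual cleartext space size for y' is r/u < r. -/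
/-- If every unit modulo an odd prime `p` is congruent to a power of `g`, then equal powers of `g`
modulo `p` have exponents congruent modulo `p - 1`. -/
theorem Nat.Prime.modEq_of_primitive_pow_modEq {p : ℕ} (hp : p.Prime) (hpodd : Odd p) {g : ℤ}
    (hg : ∀ z : ℤ, IsCoprime z (p : ℤ) → ∃ k : ℕ, z ≡ g ^ k [ZMOD (p : ℤ)])
    {a b : ℕ} (h : g ^ a ≡ g ^ b [ZMOD (p : ℤ)]) : a ≡ b [MOD (p - 1)] := by
  have : Fact p.Prime := ⟨hp⟩
  have hg0 : (g : ZMod p) ≠ 0 := by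
    intro h0
    have h2 : IsCoprime (2 : ℤ) (p : ℤ) := by
      exact_mod_cast Nat.isCoprime_iff_coprime.mpr (Nat.coprime_two_left.mpr hpodd)
    obtain ⟨k, hk⟩ := hg 2 h2
    have hk' := (ZMod.intCast_eq_intCast_iff _ _ p).mpr hk
    push_cast at hk'
    rw [h0] at hk'
    have hp3 : p ≠ 2 := by rintro rfl; exact absurd hpodd (by decide)
    rcases Nat.eq_zero_or_pos k with rfl | hkpos
    · have h10 : (1 : ZMod p) = 0 := by linear_combination hk'
      exact one_ne_zero h10
    · rw [zero_pow hkpos.ne'] at hk'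
      have h20 : ((2 : ℕ) : ZMod p) = 0 := by exact_mod_cast hk'
      exact hp3 ((Nat.prime_dvd_prime_iff_eq hp Nat.prime_two).mp
        ((ZMod.natCast_eq_zero_iff 2 p).mp h20))
  set G : (ZMod p)ˣ := Units.mk0 (g : ZMod p) hg0 with hG
  have hgen : ∀ x : (ZMod p)ˣ, x ∈ Subgroup.zpowers G := by
    intro x
    have hx : ((x.val.val : ℤ) : ZMod p) = x.val := by simp
    have hcop : IsCoprime (x.val.val : ℤ) (p : ℤ) :=
      Nat.isCoprime_iff_coprime.mpr (ZMod.val_coe_unit_coprime x)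
    obtain ⟨k, hk⟩ := hg _ hcop
    have hk' := (ZMod.intCast_eq_intCast_iff _ _ p).mpr hk
    rw [hx] at hk'
    refine ⟨(k : ℤ), Units.ext ?_⟩
    simpa [hG] using hk'.symm
  have hord : orderOf G = p - 1 := by
    rw [orderOf_eq_card_of_forall_mem_zpowers hgen, Nat.card_eq_fintype_card, ZMod.card_units]
  have hpow : G ^ a = G ^ b := by
    apply Units.ext
    have h' := (ZMod.intCast_eq_intCast_iff _ _ p).mpr h
    simpa [hG] using h'
  rw [← hord]
  exact pow_eq_pow_iff_modEq.mp hpow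


theorem benaloh_craft_faulty (p q n : ℕ) (hp : p.Prime) (hq : q.Prime)
    (hpodd : Odd p) (hqodd : Odd q) (hpq : p ≠ q)
    (hn : n = p * q) (φ : ℕ) (hφ : φ = (p - 1) * (q - 1)) (r : ℕ) (hr : 0 < r) (hrp : r ∣ p - 1)
    (hr1 : Nat.Coprime r ((p - 1) / r)) (hr2 : Nat.Coprime r (q - 1)) (y : ℤ) (hy : IsCoprime y (n : ℤ))
    (g : ℤ)
    (hg : ∀ z : ℤ, IsCoprime z (p : ℤ) → ∃ k : ℕ, z ≡ g ^ k [ZMOD (p : ℤ)])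
    (α : ℕ) (hα : y ≡ g ^ α [ZMOD (p : ℤ)])
    (hcop : Nat.Coprime α r) (u : ℕ) (hur : u ∣ r) (hu1 : 1 < u) (hu2 : u < r) :
    ¬ ((y ^ u) ^ (φ / r) ≡ 1 [ZMOD (n : ℤ)]) ∧
    (∀ β : ℕ, (y ^ u ≡ g ^ β [ZMOD (p : ℤ)]) → Nat.gcd β r = u) ∧
    r / u < r := by
  obtain ⟨m, hm⟩ := hrp
  have hm0 : 0 < m := by
    have := hp.two_le
    rcases Nat.eq_zero_or_pos m with rfl | h
    · omega
    · exact h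
  have hyu : y ^ u ≡ g ^ (α * u) [ZMOD (p : ℤ)] := by
    rw [pow_mul]
    exact hα.pow u
  refine ⟨fun h => ?_, fun β hβ => ?_, Nat.div_lt_self hr hu1⟩
  · have hdiv : φ / r = m * (q - 1) := by
      rw [hφ, hm, mul_assoc, Nat.mul_div_cancel_left _ hr]
    have hpn : (p : ℤ) ∣ (n : ℤ) := by
      rw [hn]; exact_mod_cast dvd_mul_right p q
    have h1 : g ^ (α * u * (m * (q - 1))) ≡ g ^ 0 [ZMOD (p : ℤ)] := by
      rw [pow_mul, pow_zero, ← hdiv]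
      exact (hyu.pow _).symm.trans (h.of_dvd hpn)
    have h2 := (Nat.modEq_zero_iff_dvd).mp (hp.modEq_of_primitive_pow_modEq hpodd hg h1)
    have h3 : m * r ∣ m * (u * α * (q - 1)) := by
      convert h2 using 1
      · rw [hm, mul_comm]
      · ring
    have h4 : r ∣ u :=
      hcop.symm.dvd_of_dvd_mul_right
        (hr2.dvd_of_dvd_mul_right (Nat.dvd_of_mul_dvd_mul_left hm0 h3))
    exact absurd (Nat.le_of_dvd (by omega) h4) (by omega)
  · have h1 : β ≡ α * u [MOD r] :=
      (hp.modEq_of_primitive_pow_modEq hpodd hg (hβ.symm.trans hyu)).of_dvd ⟨m, hm⟩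
    rw [h1.gcd_eq, Nat.Coprime.gcd_mul_left_cancel u hcop]
    exact Nat.gcd_eq_left hur
end

section
/- Let p and q be distinct odd primes, n = pq, φ = (p−1)(q−1), and let r be a positive integer with r ∣ p−1, gcd(r, (p−1)/r) = 1 and gcd(r, q−1) = 1. Let y be an integer coprime to n, g a primitive root modulo p, and α an integer with y ≡ g^α (mod p), and assume gcd(α, r) = 1. Then for every integer m and every integer u coprime to n, (y^m·u^r)^{φ/r} ≡ 1 (mod n) if and only if m ≡ 0 (mod r). -/
theorem ZMod.intCast_ne_zero_of_isCoprime {p : ℕ} (hp : p.Prime) {z : ℤ}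
    (hz : IsCoprime z (p : ℤ)) : (z : ZMod p) ≠ 0 := by
  have := Fact.mk hp
  intro h
  have hdvd := (ZMod.intCast_zmod_eq_zero_iff_dvd z p).1 h
  exact (Nat.prime_iff_prime_int.1 hp).not_isUnit (hz.symm.isUnit_of_dvd hdvd)

theorem ZMod.orderOf_eq_sub_one_of_forall_eq_pow_s16 {p : ℕ} [Fact p.Prime] (hodd : Odd p)
    {a : ZMod p} (ha : ∀ b : ZMod p, b ≠ 0 → ∃ k : ℕ, b = a ^ k) : orderOf a = p - 1 := by
  have hp : p.Prime := Fact.out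
  have : Fact (2 < p) := ⟨lt_of_le_of_ne hp.two_le fun h => by
    rw [← h] at hodd; exact absurd hodd (by decide)⟩
  have ha0 : a ≠ 0 := by
    rintro rfl
    obtain ⟨k, hk⟩ := ha (-1) (neg_ne_zero.2 one_ne_zero)
    rcases eq_or_ne k 0 with rfl | hk0
    · exact ZMod.neg_one_ne_one (by simpa using hk)
    · rw [zero_pow hk0] at hk
      exact neg_ne_zero.2 one_ne_zero hk
  have hgen : ∀ x : (ZMod p)ˣ, x ∈ Subgroup.zpowers (Units.mk0 a ha0) := by
    intro x
    obtain ⟨k, hk⟩ := ha x x.ne_zero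
    exact ⟨k, Units.ext (by simp [hk])⟩
  have h := orderOf_eq_card_of_forall_mem_zpowers hgen
  rwa [← orderOf_units, Units.val_mk0, Nat.card_eq_fintype_card, ZMod.card_units] at h

theorem benaloh_zero_test (p q n : ℕ) (hp : p.Prime) (hq : q.Prime)
    (hpodd : Odd p) (hqodd : Odd q) (hpq : p ≠ q)
    (hn : n = p * q) (φ : ℕ) (hφ : φ = (p - 1) * (q - 1)) (r : ℕ) (hr : 0 < r) (hrp : r ∣ p - 1)
    (hr1 : Nat.Coprime r ((p - 1) / r)) (hr2 : Nat.Coprime r (q - 1)) (y : ℤ) (hy : IsCoprime y (n : ℤ))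
    (g : ℤ)
    (hg : ∀ z : ℤ, IsCoprime z (p : ℤ) → ∃ k : ℕ, z ≡ g ^ k [ZMOD (p : ℤ)])
    (α : ℕ) (hα : y ≡ g ^ α [ZMOD (p : ℤ)])
    (hcop : Nat.Coprime α r) :
    ∀ (m : ℕ) (u : ℤ), IsCoprime u (n : ℤ) →
      ((y ^ m * u ^ r) ^ (φ / r) ≡ 1 [ZMOD (n : ℤ)] ↔ m ≡ 0 [MOD r]) := by
  intro m u hu
  have := Fact.mk hp
  have := Fact.mk hq
  subst hn hφ
  obtain ⟨d, hd⟩ := hrp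
  have hd0 : 0 < d := Nat.pos_of_ne_zero fun h => by
    have := hp.two_le
    simp only [h, mul_zero] at hd
    omega
  have he : (p - 1) * (q - 1) / r = d * (q - 1) := by
    rw [hd, mul_assoc, Nat.mul_div_cancel_left _ hr]
  push_cast at hy hu
  have hup : (u : ZMod p) ≠ 0 := ZMod.intCast_ne_zero_of_isCoprime hp hu.of_mul_right_left
  have huq : (u : ZMod q) ≠ 0 := ZMod.intCast_ne_zero_of_isCoprime hq hu.of_mul_right_right
  have hyq : (y : ZMod q) ≠ 0 := ZMod.intCast_ne_zero_of_isCoprime hq hy.of_mul_right_right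
  have hord : orderOf (g : ZMod p) = p - 1 := by
    refine ZMod.orderOf_eq_sub_one_of_forall_eq_pow_s16 hpodd fun b hb => ?_
    obtain ⟨z, rfl⟩ := ZMod.intCast_surjective b
    have hz : IsCoprime z (p : ℤ) := by
      refine ((Nat.prime_iff_prime_int.1 hp).coprime_iff_not_dvd.2 fun h => hb ?_).symm
      exact (ZMod.intCast_zmod_eq_zero_iff_dvd z p).2 h
    obtain ⟨k, hk⟩ := hg z hz
    exact ⟨k, by exact_mod_cast (ZMod.intCast_eq_intCast_iff _ _ p).2 hk⟩
  have hyg : (y : ZMod p) = (g : ZMod p) ^ α := by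
    exact_mod_cast (ZMod.intCast_eq_intCast_iff _ _ p).2 hα
  have hmodq : (y ^ m * u ^ r) ^ (d * (q - 1)) ≡ 1 [ZMOD (q : ℤ)] := by
    rw [← ZMod.intCast_eq_intCast_iff]
    push_cast
    rw [mul_comm d, pow_mul, ZMod.pow_card_sub_one_eq_one, one_pow]
    exact mul_ne_zero (pow_ne_zero _ hyq) (pow_ne_zero _ huq)
  have hmodp : (y ^ m * u ^ r) ^ (d * (q - 1)) ≡ 1 [ZMOD (p : ℤ)] ↔ r ∣ m := by
    have hu1 : ((u : ZMod p) ^ r) ^ (d * (q - 1)) = 1 := by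
      rw [← pow_mul, ← mul_assoc, ← hd, pow_mul, ZMod.pow_card_sub_one_eq_one hup, one_pow]
    rw [← ZMod.intCast_eq_intCast_iff]
    push_cast
    rw [mul_pow, hu1, mul_one, hyg, ← pow_mul, ← pow_mul, ← orderOf_dvd_iff_pow_eq_one, hord, hd,
      show α * (m * (d * (q - 1))) = α * m * (q - 1) * d by ring,
      Nat.mul_dvd_mul_iff_right hd0, hr2.dvd_mul_right, hcop.symm.dvd_mul_left]
  have hpq' : (p : ℤ).natAbs.Coprime (q : ℤ).natAbs := by
    simpa using (Nat.coprime_primes hp hq).2 hpq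
  rw [he, Nat.cast_mul, ← Int.modEq_and_modEq_iff_modEq_mul hpq', Nat.modEq_zero_iff_dvd, hmodp]
  exact and_iff_left hmodq
end
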